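/- Runtime of the randomized GP algorithm under adversarial failures (counting formulation): let n ≥ 2, let ε = √(ln n / (n−1)), let f : ℕ with (f : ℝ) < (n−1)(1−ε), let p = 1 − f/(n−1) (so p − ε > 0), let c > 1 be a real constant, and set T = (c/(p−ε))·(⌈log₂(n−1)⌉+1). For v : Fin (n−1) → Bool let ext v : ℕ → Bool be ext v i = v ⟨i, h⟩ for i < n−1 and ext v i = true for i ≥ n−1. Then the number of vectors v : Fin (n−1) → Bool having exactly f coordinates equal to false and satisfying T < (HGP (n−1) (ext v) : ℝ) is at most (n³/(n²−1)) · exp( − ((c−1)²/(2c)) · (⌈log₂(n−1)⌉ − 1) ) · (Nat.choose (n−1) f). Equivalently, for a uniformly random set of exactly f failed processors among the n−1 non-start processors, the randomized GP algorithm exceeds runtime T with probability at most (n³/(n²−1))·exp(−((c−1)²/(2c))(⌈log₂(n−1)⌉−1)). -/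

import Mathlib

def tailSeq (b : ℕ → Bool) : ℕ → Bool := fun i => b (i+1)
def oddSeq (b : ℕ → Bool) : ℕ → Bool := fun i => b (2*i)
def evenSeq (b : ℕ → Bool) : ℕ → Bool := fun i => b (2*i+1)

/-- Time complexity of the GP algorithm with `n` uninformed processors under
failure pattern `b` (`b i = true` means the `i`-th request is successful). -/
def HGP : ℕ → (ℕ → Bool) → ℕ
  | 0, _ => 0
  | n+1, b =>
    if b 0 then
      1 + max (HGP ((n+1)/2) (oddSeq (tailSeq b))) (HGP (n/2) (evenSeq (tailSeq b)))
    else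
      1 + HGP n (tailSeq b)
decreasing_by all_goals omega

/-- Extension of a finite failure vector to an infinite one (all further
requests succeed). -/
def extPattern (m : ℕ) (v : Fin m → Bool) : ℕ → Bool :=
  fun i => if h : i < m then v ⟨i, h⟩ else true


def consSeq (x : Bool) (b : ℕ → Bool) : ℕ → Bool
  | 0 => x
  | i+1 => b i

theorem tailSeq_consSeq (x : Bool) (b : ℕ → Bool) : tailSeq (consSeq x b) = b := rfl

theorem oddSeq_consSeq (x : Bool) (b : ℕ → Bool) :
    oddSeq (consSeq x b) = consSeq x (evenSeq b) := by
  funext i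
  cases i with
  | zero => rfl
  | succ i => rfl

theorem evenSeq_consSeq (x : Bool) (b : ℕ → Bool) :
    evenSeq (consSeq x b) = oddSeq b := rfl

theorem HGP_zero (b : ℕ → Bool) : HGP 0 b = 0 := by rw [HGP]

theorem HGP_succ (n : ℕ) (b : ℕ → Bool) : HGP (n+1) b =
    if b 0 then
      1 + max (HGP ((n+1)/2) (oddSeq (tailSeq b))) (HGP (n/2) (evenSeq (tailSeq b)))
    else
      1 + HGP n (tailSeq b) := by rw [HGP]

/-- iid expectation -/
def EE (p : ℝ) : ℕ → ((ℕ → Bool) → ℝ) → ℝ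
  | 0, g => g (fun _ => true)
  | m+1, g => p * EE p m (fun b => g (consSeq true b))
      + (1 - p) * EE p m (fun b => g (consSeq false b))

theorem EE_odd_even (p : ℝ) (m : ℕ) : ∀ g : (ℕ → Bool) → ℝ,
    EE p m (fun b => g (oddSeq b)) = EE p ((m+1)/2) g ∧
    EE p m (fun b => g (evenSeq b)) = EE p (m/2) g := by
  induction m with
  | zero => intro g; exact ⟨rfl, rfl⟩
  | succ m ih =>
    intro g
    constructor
    · have h : (m+1+1)/2 = m/2 + 1 := by omega
      rw [h]
      simp only [EE, oddSeq_consSeq]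
      rw [(ih (fun b => g (consSeq true b))).2, (ih (fun b => g (consSeq false b))).2]
    · simp only [EE, evenSeq_consSeq]
      rw [(ih g).1]; ring

theorem EE_mono (p : ℝ) (hp0 : 0 ≤ p) (hp1 : p ≤ 1) (m : ℕ) :
    ∀ g h : (ℕ → Bool) → ℝ, (∀ b, g b ≤ h b) → EE p m g ≤ EE p m h := by
  induction m with
  | zero => intro g h H; exact H _
  | succ m ih =>
    intro g h H
    have h1 := ih _ _ (fun b => H (consSeq true b))
    have h2 := ih _ _ (fun b => H (consSeq false b))
    have h3 : 0 ≤ 1 - p := by linarith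
    simp only [EE]
    gcongr

theorem EE_mul (p y : ℝ) (m : ℕ) : ∀ g : (ℕ → Bool) → ℝ,
    EE p m (fun b => y * g b) = y * EE p m g := by
  induction m with
  | zero => intro g; rfl
  | succ m ih => intro g; simp only [EE, ih]; ring

theorem EE_add (p : ℝ) (m : ℕ) : ∀ g h : (ℕ → Bool) → ℝ,
    EE p m (fun b => g b + h b) = EE p m g + EE p m h := by
  induction m with
  | zero => intro g h; rfl
  | succ m ih => intro g h; simp only [EE, ih]; ring

theorem EE_bound (p c y : ℝ) (hp0 : 0 < p) (hp1 : p < 1) (hc : 1 < c)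
    (hy1 : 1 ≤ y) (hy : y * (p + (1 - p) * c) = c) (m : ℕ) :
    ∀ k : ℕ, m < 2^k → EE p m (fun b => y ^ HGP m b) ≤ ((m:ℝ)+1) * c^k := by
  induction m using Nat.strong_induction_on with
  | _ m ih =>
    intro k hk
    cases m with
    | zero =>
      simp only [EE, HGP_zero]
      have := one_le_pow₀ hc.le (n := k)
      simpa using this
    | succ n =>
      cases k with
      | zero => simp at hk
      | succ k =>
        have hk' : 2^(k+1) = 2 * 2^k := by ring
        have e1 := ih ((n+1)/2) (by omega) k (by omega)
        have e2 := ih (n/2) (by omega) k (by omega)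
        have e3 := ih n (by omega) (k+1) (by omega)
        have hsplit : (((n+1)/2 : ℕ) : ℝ) + ((n/2 : ℕ) : ℝ) = n := by
          have : (n+1)/2 + n/2 = n := by omega
          exact_mod_cast this
        have t1 : EE p n (fun b => y ^ HGP (n+1) (consSeq true b)) ≤
            y * (((n:ℝ) + 2) * c^k) := by
          calc EE p n (fun b => y ^ HGP (n+1) (consSeq true b))
              ≤ EE p n (fun b => y * (y ^ HGP ((n+1)/2) (oddSeq b) + y ^ HGP (n/2) (evenSeq b))) := by
                apply EE_mono p hp0.le hp1.le
                intro b
                rw [HGP_succ, tailSeq_consSeq]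
                simp only [consSeq, if_true]
                rw [pow_add, pow_one]
                have hy0 : 0 < y := by linarith
                gcongr
                rcases max_choice (HGP ((n+1)/2) (oddSeq b)) (HGP (n/2) (evenSeq b)) with h | h
                · rw [h]; have : 0 < y ^ HGP (n/2) (evenSeq b) := by positivity
                  linarith
                · rw [h]; have : 0 < y ^ HGP ((n+1)/2) (oddSeq b) := by positivity
                  linarith
            _ = y * (EE p ((n+1)/2) (fun b => y ^ HGP ((n+1)/2) b) + EE p (n/2) (fun b => y ^ HGP (n/2) b)) := by
                rw [EE_mul, EE_add, (EE_odd_even p n (fun b => y ^ HGP ((n+1)/2) b)).1,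
                  (EE_odd_even p n (fun b => y ^ HGP (n/2) b)).2]
            _ ≤ y * (((n:ℝ) + 2) * c^k) := by
                apply mul_le_mul_of_nonneg_left _ (by linarith)
                rw [← hsplit]; linarith
        have t2 : EE p n (fun b => y ^ HGP (n+1) (consSeq false b)) ≤
            y * (((n:ℝ) + 1) * c^(k+1)) := by
          have : (fun b => y ^ HGP (n+1) (consSeq false b)) = fun b => y * y ^ HGP n b := by
            funext b
            rw [HGP_succ, tailSeq_consSeq]
            simp [consSeq, pow_add]
          rw [this, EE_mul]
          exact mul_le_mul_of_nonneg_left e3 (by linarith)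
        have hck : 0 < c^k := by positivity
        have hq : 0 < 1 - p := by linarith
        simp only [EE]
        calc _ ≤ p * (y * (((n:ℝ) + 2) * c^k)) + (1-p) * (y * (((n:ℝ) + 1) * c^(k+1))) := by gcongr
          _ ≤ p * (y * (((n:ℝ) + 2) * c^k)) + (1-p) * (y * (((n:ℝ) + 2) * c^(k+1))) := by
              gcongr; norm_num
          _ = (y * (p + (1 - p) * c)) * ((n:ℝ)+2) * c^k := by ring
          _ = _ := by rw [hy]; push_cast; ring

theorem HGP_odd_even_le (m : ℕ) : ∀ b : ℕ → Bool,
    HGP ((m+1)/2) (oddSeq b) ≤ HGP m b ∧ HGP (m/2) (evenSeq b) ≤ HGP m b := by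
  induction m using Nat.strong_induction_on with
  | _ m ih =>
    intro b
    cases m with
    | zero => simp [HGP_zero]
    | succ n =>
      have h : (n+1+1)/2 = n/2 + 1 := by omega
      have ho : ∀ b, tailSeq (oddSeq b) = evenSeq (tailSeq b) := fun b => rfl
      have he : ∀ b, evenSeq b = oddSeq (tailSeq b) := fun b => rfl
      have hz : oddSeq b 0 = b 0 := rfl
      rw [h, HGP_succ, HGP_succ, ho, hz, he b]
      have a1 := ih n (by omega) (tailSeq b)
      have a2 := ih (n/2) (by omega) (evenSeq (tailSeq b))
      cases hb : b 0
      · simp only [Bool.false_eq_true, if_false]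
        omega
      · simp only [if_true]
        omega

theorem HGP_anti (m : ℕ) : ∀ b b' : ℕ → Bool, (∀ i, b i = true → b' i = true) →
    HGP m b' ≤ HGP m b := by
  induction m using Nat.strong_induction_on with
  | _ m ih =>
    intro b b' H
    cases m with
    | zero => simp [HGP_zero]
    | succ n =>
      have a1 := ih n (by omega) (tailSeq b) (tailSeq b') (fun i => H _)
      have a2 := ih ((n+1)/2) (by omega) (oddSeq (tailSeq b)) (oddSeq (tailSeq b')) (fun i => H _)
      have a3 := ih (n/2) (by omega) (evenSeq (tailSeq b)) (evenSeq (tailSeq b')) (fun i => H _)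
      have a4 := HGP_odd_even_le n (tailSeq b)
      have H0 := H 0
      rw [HGP_succ, HGP_succ]
      cases hb : b 0 <;> cases hb' : b' 0 <;> simp_all <;> omega

theorem EE_eq_sum (p : ℝ) (m : ℕ) : ∀ g : (ℕ → Bool) → ℝ,
    EE p m g = ∑ v : Fin m → Bool, (∏ i, (if v i then p else 1 - p)) * g (extPattern m v) := by
  induction m with
  | zero =>
    intro g
    simp [EE]
    rfl
  | succ m ih =>
    intro g
    have hext : ∀ x (v : Fin m → Bool),
        extPattern (m+1) (Fin.cons x v : Fin (m+1) → Bool) = consSeq x (extPattern m v) := by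
      intro x v
      funext i
      cases i with
      | zero => simp [extPattern, consSeq]
      | succ i =>
        simp only [extPattern, consSeq]
        by_cases h : i < m
        · have h' : i + 1 < m + 1 := by omega
          rw [dif_pos h, dif_pos h']
          exact Fin.cons_succ (α := fun _ => Bool) x v ⟨i, h⟩
        · have h' : ¬ i + 1 < m + 1 := by omega
          rw [dif_neg h, dif_neg h']
    have hext2 : ∀ x (v : Fin m → Bool),
        extPattern (m+1) ((Fin.consEquiv (fun _ : Fin (m+1) => Bool)) (x, v)) =
          consSeq x (extPattern m v) := hext
    rw [← (Fin.consEquiv (fun _ : Fin (m+1) => Bool)).sum_comp, Fintype.sum_prod_type]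
    simp only [EE, ih, hext2, Fin.consEquiv_apply, Fintype.sum_bool, Fin.prod_univ_succ, Fin.cons_zero,
      Fin.cons_succ, Finset.mul_sum, mul_assoc, if_true, Bool.false_eq_true, if_false]

theorem log_bound (c : ℝ) (hc : 1 < c) : Real.log c - (c - 1) ≤ -((c-1)^2/(2*c)) := by
  have h0 : 0 < c := by linarith
  have h1 : Real.log c ≤ Real.sinh (Real.log c) :=
    Real.self_le_sinh_iff.2 (Real.log_nonneg hc.le)
  rw [Real.sinh_eq, Real.exp_neg, Real.exp_log h0] at h1
  have : -((c-1)^2/(2*c)) = (c - c⁻¹)/2 - (c-1) := by field_simp; ring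
  linarith

theorem two_point (q t : ℝ) (h0 : 0 ≤ q) (h1 : q ≤ 1) :
    q * Real.exp (-t) + (1 - q) ≤ Real.exp (-t * q + t^2/8) := by
  let qq : unitInterval := ⟨q, h0, h1⟩
  let μ : MeasureTheory.Measure ℝ := ProbabilityTheory.bernoulliMeasure (1:ℝ) 0 qq
  have hintegral : ∀ g : ℝ → ℝ, ∫ x, g x ∂μ = q * g 1 + (1 - q) * g 0 := by
    intro g
    simp [μ, ProbabilityTheory.integral_bernoulliMeasure, qq]
  have key := (ProbabilityTheory.hasSubgaussianMGF_of_mem_Icc (μ := μ) (X := id) (a := 0) (b := 1)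
    aemeasurable_id (by
      have hs : MeasurableSet {x : ℝ | id x ∈ Set.Icc (0:ℝ) 1} := measurableSet_Icc
      rw [MeasureTheory.ae_iff]
      simp only [μ]
      rw [ProbabilityTheory.bernoulliMeasure_apply_of_notMem_of_notMem]
      · exact hs.compl
      · simp
      · simp)).mgf_le (-t)
  rw [ProbabilityTheory.mgf, hintegral] at key
  have hmean : ∫ x, id x ∂μ = q := by rw [hintegral]; simp
  rw [hmean] at key
  have e : ((((‖(1:ℝ) - 0‖₊ / 2)^2 : NNReal) : ℝ) * (-t)^2 / 2) = t^2/8 := by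
    simp; ring
  rw [e] at key
  have e1 : Real.exp (-t * (id 1 - q)) = Real.exp (-t) * Real.exp (t*q) := by
    rw [← Real.exp_add]; congr 1; simp; ring
  have e2 : Real.exp (-t * (id 0 - q)) = Real.exp (t*q) := by
    congr 1; simp
  rw [e1, e2] at key
  have e3 : Real.exp (-t * q + t^2/8) = Real.exp (t^2/8) * Real.exp (-(t*q)) := by
    rw [← Real.exp_add]; congr 1; ring
  rw [e3]
  have e4 : Real.exp (t*q) * Real.exp (-(t*q)) = 1 := by rw [← Real.exp_add]; simp
  have := mul_le_mul_of_nonneg_right key (Real.exp_pos (-(t*q))).le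
  calc q * Real.exp (-t) + (1 - q)
      = (q * Real.exp (-t) + (1 - q)) * (Real.exp (t*q) * Real.exp (-(t*q))) := by rw [e4, mul_one]
    _ ≤ _ := by linarith

open Classical in
noncomputable def layerCard (m : ℕ) (B : (Fin m → Bool) → Prop) (j : ℕ) : ℕ :=
  (Finset.univ.filter (fun v : Fin m → Bool =>
    (Finset.univ.filter (fun i => v i = false)).card = j ∧ B v)).card

theorem count_false (m : ℕ) (v : Fin m → Bool) :
    (Finset.univ.filter (fun i => v i = true)).card +
    (Finset.univ.filter (fun i => v i = false)).card = m := by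
  have := Finset.card_filter_add_card_filter_not (s := (Finset.univ : Finset (Fin m)))
    (fun i => v i = true)
  simpa using this

open Classical in
theorem layerCard_eq (m : ℕ) (B : (Fin m → Bool) → Prop) (r j : ℕ) (hj : r + j = m) :
    layerCard m B j = (Finset.univ.filter (fun S : Finset (Fin m) =>
      S.card = r ∧ B (fun i => decide (i ∈ S)))).card := by
  unfold layerCard
  refine Finset.card_nbij' (fun v => Finset.univ.filter (fun i => v i = true))
    (fun S i => decide (i ∈ S)) ?_ ?_ ?_ ?_
  · intro v hv
    have h := count_false m v
    simp only [Finset.coe_filter, Finset.mem_univ, true_and, Set.mem_ofPred_eq] at hv ⊢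
    refine ⟨by omega, ?_⟩
    convert hv.2 using 2
    simp
  · intro S hS
    have h := count_false m (fun i => decide (i ∈ S))
    simp only [Finset.coe_filter, Finset.mem_univ, true_and, Set.mem_ofPred_eq] at hS ⊢
    refine ⟨?_, hS.2⟩
    have : (Finset.univ.filter (fun i => decide (i ∈ S) = true)) = S := by ext i; simp
    rw [this] at h
    omega
  · intro v hv
    funext i
    simp
  · intro S hS
    ext i
    simp

open Classical in
theorem layer_mono (m : ℕ) (B : (Fin m → Bool) → Prop)
    (hB : ∀ v w, (∀ i, v i = true → w i = true) → B w → B v) (j : ℕ) (hj : j < m) :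
    (layerCard m B j : ℝ) / (m.choose j) ≤ (layerCard m B (j+1) : ℝ) / (m.choose (j+1)) := by
  obtain ⟨r, rfl⟩ : ∃ r, m = (r + 1) + j := ⟨m - j - 1, by omega⟩
  rw [layerCard_eq _ B (r+1) j rfl, layerCard_eq _ B r (j+1) (by omega)]
  set 𝒜 := (Finset.univ.filter (fun S : Finset (Fin (r+1+j)) =>
      S.card = r + 1 ∧ B (fun i => decide (i ∈ S))))
  have hA : (𝒜 : Set (Finset (Fin (r+1+j)))).Sized (r+1) := by
    intro S hS
    simp only [𝒜, Finset.coe_filter, Set.mem_ofPred_eq] at hS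
    exact hS.2.1
  have h := Finset.local_lubell_yamamoto_meshalkin_inequality_div (𝕜 := ℝ) (r := r+1) (by omega) hA
  simp only [Fintype.card_fin, Nat.add_sub_cancel] at h
  have c1 : (r+1+j).choose j = (r+1+j).choose (r+1) := (Nat.choose_symm_add).symm
  have c2 : (r+1+j).choose (j+1) = (r+1+j).choose r := by
    apply Nat.choose_symm_of_eq_add; omega
  rw [c1, c2]
  refine h.trans ?_
  gcongr
  intro S hS
  rw [Finset.mem_shadow_iff] at hS
  obtain ⟨s, hs, a, ha, rfl⟩ := hS
  simp only [𝒜, Finset.mem_filter, Finset.mem_univ, true_and] at hs ⊢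
  refine ⟨by rw [Finset.card_erase_of_mem ha]; omega, hB _ _ ?_ hs.2⟩
  intro i
  simp only [decide_eq_true_eq]
  exact Finset.mem_of_mem_erase

theorem layer_mono' (m : ℕ) (B : (Fin m → Bool) → Prop)
    (hB : ∀ v w, (∀ i, v i = true → w i = true) → B w → B v) (f j : ℕ) (hfj : f ≤ j)
    (hj : j ≤ m) :
    (layerCard m B f : ℝ) / (m.choose f) ≤ (layerCard m B j : ℝ) / (m.choose j) := by
  induction j, hfj using Nat.le_induction with
  | base => exact le_rfl
  | succ j hfj ih => exact (ih (by omega)).trans (layer_mono m B hB j (by omega))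

open Classical in
theorem EE_layers (p : ℝ) (m : ℕ) (P : (ℕ → Bool) → Prop) :
    EE p m (fun b => if P b then 1 else 0) = ∑ j ∈ Finset.range (m+1),
      (1-p)^j * p^(m-j) * (layerCard m (fun v => P (extPattern m v)) j : ℝ) := by
  rw [EE_eq_sum]
  rw [← Finset.sum_fiberwise_of_maps_to (t := Finset.range (m+1))
    (g := fun v : Fin m → Bool => (Finset.univ.filter (fun i => v i = false)).card)]
  · apply Finset.sum_congr rfl
    intro j hj
    unfold layerCard
    rw [← Finset.filter_filter, Finset.card_filter (fun v => P (extPattern m v)), Nat.cast_sum,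
      Finset.mul_sum]
    apply Finset.sum_congr rfl
    intro v hv
    simp only [Finset.mem_filter, Finset.mem_univ, true_and] at hv
    have hcf := count_false m v
    rw [Finset.prod_ite, Finset.prod_const, Finset.prod_const]
    simp only [Bool.not_eq_true]
    have : (Finset.univ.filter (fun i => v i = true)).card = m - j := by omega
    rw [hv, this]
    push_cast
    ring
  · intro v _
    have hcf := count_false m v
    rw [Finset.mem_range]; omega

theorem tail_bound (m f : ℕ) (q ε : ℝ) (h0 : 0 ≤ q) (h1 : q ≤ 1) (hε : 0 ≤ ε)
    (hq : (m:ℝ) * q = f + m * ε) :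
    1 - Real.exp (-2 * (m * ε^2)) ≤ ∑ j ∈ (Finset.range (m+1)).filter (fun j => f ≤ j),
      q^j * (1-q)^(m-j) * (m.choose j : ℝ) := by
  have htot : ∑ j ∈ Finset.range (m+1), q^j * (1-q)^(m-j) * (m.choose j : ℝ) = 1 := by
    rw [← add_pow]; simp
  rw [← Finset.sum_filter_add_sum_filter_not _ (fun j => f ≤ j)] at htot
  have hlow : ∑ j ∈ (Finset.range (m+1)).filter (fun j => ¬ f ≤ j),
      q^j * (1-q)^(m-j) * (m.choose j : ℝ) ≤ Real.exp (-2 * (m * ε^2)) := by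
    have h1q : 0 ≤ 1 - q := by linarith
    calc _ ≤ ∑ j ∈ (Finset.range (m+1)).filter (fun j => ¬ f ≤ j),
          Real.exp (4*ε*f) * ((q * Real.exp (-(4*ε)))^j * (1-q)^(m-j) * (m.choose j : ℝ)) := by
          apply Finset.sum_le_sum
          intro j hj
          have hj' : j < f := by simpa using (Finset.mem_filter.1 hj).2
          have : 1 ≤ Real.exp (4*ε*f) * Real.exp (-(4*ε))^j := by
            rw [← Real.exp_nat_mul, ← Real.exp_add]
            apply Real.one_le_exp
            have : (j:ℝ) ≤ f := by exact_mod_cast hj'.le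
            nlinarith
          have hn : 0 ≤ q^j * (1-q)^(m-j) * (m.choose j : ℝ) := by positivity
          rw [mul_pow]
          nlinarith
      _ ≤ ∑ j ∈ Finset.range (m+1),
          Real.exp (4*ε*f) * ((q * Real.exp (-(4*ε)))^j * (1-q)^(m-j) * (m.choose j : ℝ)) := by
          apply Finset.sum_le_sum_of_subset_of_nonneg (Finset.filter_subset _ _)
          intro j _ _
          positivity
      _ = Real.exp (4*ε*f) * (q * Real.exp (-(4*ε)) + (1-q))^m := by
          rw [← Finset.mul_sum, ← add_pow]
      _ ≤ Real.exp (4*ε*f) * (Real.exp (-(4*ε) * q + (4*ε)^2/8))^m := by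
          gcongr
          exact two_point q (4*ε) h0 h1
      _ = Real.exp (-2 * (m * ε^2)) := by
          rw [← Real.exp_nat_mul, ← Real.exp_add]
          congr 1
          linear_combination (-(4*ε)) * hq
  linarith

theorem iid_bound (p c T : ℝ) (hp0 : 0 < p) (hp1 : p < 1) (hc : 1 < c) (m k : ℕ)
    (hk : m < 2^k) (hT : T = c / p * k) (P : (ℕ → Bool) → Prop) [DecidablePred P]
    (hP : ∀ b, P b → T < HGP m b) :
    EE p m (fun b => if P b then 1 else 0) ≤
      ((m:ℝ)+1) * Real.exp (-((c-1)^2/(2*c)) * k) := by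
  have hc0 : 0 < c := by linarith
  have hden : 0 < p + (1-p)*c := by nlinarith
  set y := c / (p + (1-p)*c) with hy
  have hy1 : 1 < y := by rw [hy, lt_div_iff₀ hden]; nlinarith
  have hyc : y * (p + (1 - p) * c) = c := div_mul_cancel₀ _ hden.ne'
  have hb := EE_bound p c y hp0 hp1 hc hy1.le hyc m k hk
  have hlog : p * (c-1) / c ≤ Real.log y := by
    have h1 := Real.one_sub_inv_le_log_of_pos (x := y) (by linarith)
    have : 1 - y⁻¹ = p * (c-1)/c := by rw [hy, inv_div]; field_simp; ring
    linarith
  have hmk : EE p m (fun b => Real.exp ((c-1)*k) * (if P b then 1 else 0)) ≤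
      EE p m (fun b => y ^ HGP m b) := by
    apply EE_mono p hp0.le hp1.le
    intro b
    by_cases h : P b
    · rw [if_pos h, mul_one]
      have hy' : y ^ HGP m b = Real.exp (HGP m b * Real.log y) := by
        rw [Real.exp_nat_mul, Real.exp_log (by linarith)]
      rw [hy']
      apply Real.exp_le_exp.2
      have hTn : 0 ≤ T := by rw [hT]; positivity
      calc (c-1)*k = T * (p * (c-1)/c) := by rw [hT]; field_simp
        _ ≤ HGP m b * Real.log y := by
          apply mul_le_mul (hP b h).le hlog _ (by positivity)
          have : 0 ≤ c - 1 := by linarith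
          positivity
    · rw [if_neg h, mul_zero]; positivity
  rw [EE_mul] at hmk
  have h3 := hmk.trans hb
  have hexp : c^k = Real.exp ((c-1)*k) * Real.exp ((Real.log c - (c-1))*k) := by
    rw [← Real.exp_add, ← Real.exp_log (pow_pos hc0 k), Real.log_pow]
    congr 1; ring
  rw [hexp] at h3
  have h4 : EE p m (fun b => if P b then 1 else 0) ≤
      ((m:ℝ)+1) * Real.exp ((Real.log c - (c-1))*k) := by
    have hpos := Real.exp_pos ((c-1)*k)
    refine le_of_mul_le_mul_left ?_ hpos
    linarith
  refine h4.trans ?_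
  gcongr
  exact log_bound c hc

open Classical in
/-- Runtime of the randomized GP algorithm under adversarial failures (counting
formulation): among the Boolean vectors of length `n-1` with exactly `f` false
coordinates, the fraction for which the GP runtime exceeds
`T = (c/(p-ε))(⌈log₂(n-1)⌉+1)` is at most
`(n³/(n²-1))·exp(-((c-1)²/(2c))(⌈log₂(n-1)⌉-1))`. -/
theorem randomized_gp_adversarial (n : ℕ) (hn : 2 ≤ n) (ε : ℝ)
    (hε : ε = Real.sqrt (Real.log n / ((n:ℝ) - 1)))
    (f : ℕ) (hf : (f : ℝ) < ((n:ℝ) - 1) * (1 - ε))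
    (p : ℝ) (hp : p = 1 - (f : ℝ) / ((n:ℝ) - 1))
    (c : ℝ) (hc : 1 < c)
    (T : ℝ) (hT : T = c / (p - ε) * ((Nat.clog 2 (n-1) : ℝ) + 1)) :
    ((Finset.univ.filter (fun v : Fin (n-1) → Bool =>
        (Finset.univ.filter (fun i => v i = false)).card = f ∧
        T < (HGP (n-1) (extPattern (n-1) v) : ℝ))).card : ℝ) ≤
      ((n:ℝ)^3 / ((n:ℝ)^2 - 1)) *
        Real.exp (-((c-1)^2 / (2*c)) * ((Nat.clog 2 (n-1) : ℝ) - 1)) *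
        (Nat.choose (n-1) f : ℝ) := by
  obtain ⟨m, rfl⟩ : ∃ m, n = m + 1 := ⟨n - 1, by omega⟩
  have hm1 : 1 ≤ m := by omega
  have hm : (1:ℝ) ≤ m := by exact_mod_cast hm1
  have hm0 : (0:ℝ) < m := by linarith
  have hcast : ((m+1 : ℕ) : ℝ) - 1 = m := by push_cast; ring
  rw [hcast] at hε hf hp
  simp only [Nat.add_sub_cancel] at hT ⊢
  have hlogpos : 0 < Real.log ((m+1 : ℕ) : ℝ) := Real.log_pos (by push_cast; linarith)
  have hεpos : 0 < ε := by rw [hε]; exact Real.sqrt_pos.2 (by positivity)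
  have hε2 : m * ε^2 = Real.log ((m+1 : ℕ) : ℝ) := by
    rw [hε, Real.sq_sqrt (by positivity)]; field_simp
  have hfm : f ≤ m := by
    have : (f:ℝ) < m := by nlinarith
    exact_mod_cast this.le
  have hfd : (f:ℝ) / m < 1 - ε := by rw [div_lt_iff₀ hm0]; linarith
  have hfd0 : 0 ≤ (f:ℝ) / m := by positivity
  have hp0 : 0 < p - ε := by linarith
  have hp1 : p - ε < 1 := by linarith
  set k := Nat.clog 2 m + 1 with hkdef
  have hk : m < 2^k := by
    have := Nat.le_pow_clog (b := 2) (by norm_num) m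
    rw [hkdef, pow_succ]
    omega
  have hkc : (k:ℝ) = (Nat.clog 2 m : ℝ) + 1 := by rw [hkdef]; push_cast; ring
  have hiid := iid_bound (p - ε) c T hp0 hp1 hc m k hk (by rw [hT, hkc])
    (fun b => T < (HGP m b : ℝ)) (fun b h => h)
  rw [EE_layers] at hiid
  set B : (Fin m → Bool) → Prop := fun v => T < (HGP m (extPattern m v) : ℝ) with hBdef
  have hB : ∀ v w : Fin m → Bool, (∀ i, v i = true → w i = true) → B w → B v := by
    intro v w h hw
    refine lt_of_lt_of_le hw ?_
    have : HGP m (extPattern m w) ≤ HGP m (extPattern m v) := by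
      apply HGP_anti
      intro i
      unfold extPattern
      split
      · exact h _
      · exact id
    exact_mod_cast this
  have htail := tail_bound m f (1 - (p - ε)) ε (by linarith) (by linarith) hεpos.le
    (by rw [hp]; field_simp; ring)
  have hexp : Real.exp (-2 * (m * ε^2)) = 1 / ((m+1 : ℕ) : ℝ)^2 := by
    rw [hε2]
    have : -2 * Real.log ((m+1 : ℕ) : ℝ) = -(Real.log (((m+1 : ℕ) : ℝ)^2)) := by
      rw [Real.log_pow]; push_cast; ring
    rw [this, Real.exp_neg, Real.exp_log (by positivity), one_div]
  rw [hexp] at htail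
  set R : ℝ := (layerCard m B f : ℝ) / (m.choose f) with hR
  have hR0 : 0 ≤ R := by positivity
  have hlow : R * (1 - 1 / ((m+1 : ℕ) : ℝ)^2) ≤
      ((m:ℝ)+1) * Real.exp (-((c-1)^2/(2*c)) * k) := by
    refine le_trans ?_ hiid
    refine (mul_le_mul_of_nonneg_left htail hR0).trans ?_
    rw [Finset.mul_sum]
    have hq0 : 0 ≤ 1 - (p - ε) := by linarith
    calc _ ≤ ∑ j ∈ (Finset.range (m+1)).filter (fun j => f ≤ j),
          (1-(p-ε))^j * (p-ε)^(m-j) * (layerCard m B j : ℝ) := by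
          apply Finset.sum_le_sum
          intro j hj
          rw [Finset.mem_filter, Finset.mem_range] at hj
          have hl := layer_mono' m B hB f j hj.2 (by omega)
          have hcp : (0:ℝ) < m.choose j := by
            exact_mod_cast Nat.choose_pos (by omega)
          rw [le_div_iff₀ hcp] at hl
          have hw : 0 ≤ (1-(p-ε))^j * (p-ε)^(m-j) := by positivity
          have := mul_le_mul_of_nonneg_left hl hw
          rw [sub_sub_cancel]
          linarith
      _ ≤ _ := by
          apply Finset.sum_le_sum_of_subset_of_nonneg (Finset.filter_subset _ _)
          intro j _ _
          positivity
  have hgoal : ((Finset.univ.filter (fun v : Fin m → Bool =>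
        (Finset.univ.filter (fun i => v i = false)).card = f ∧
        T < (HGP m (extPattern m v) : ℝ))).card : ℝ) = R * (m.choose f) := by
    have hcp : (0:ℝ) < m.choose f := by
      exact_mod_cast Nat.choose_pos hfm
    rw [hR, div_mul_cancel₀ _ hcp.ne']
    unfold layerCard
    congr!
  refine hgoal.le.trans ?_
  apply mul_le_mul_of_nonneg_right _ (by positivity)
  set N : ℝ := ((m+1 : ℕ) : ℝ) with hN
  have hN1 : (m:ℝ) + 1 = N := by rw [hN]; push_cast; ring
  have hN2 : 2 ≤ N := by linarith
  have hd : 0 < N^2 - 1 := by nlinarith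
  have hweak : Real.exp (-((c-1)^2/(2*c)) * k) ≤
      Real.exp (-((c-1)^2/(2*c)) * ((Nat.clog 2 m : ℝ) - 1)) := by
    apply Real.exp_le_exp.2
    rw [hkc]
    have : 0 ≤ (c-1)^2/(2*c) := by positivity
    nlinarith
  rw [hN1] at hlow
  have h5 : R * (1 - 1/N^2) ≤ N * Real.exp (-((c-1)^2/(2*c)) * ((Nat.clog 2 m : ℝ) - 1)) :=
    hlow.trans (mul_le_mul_of_nonneg_left hweak (by linarith))
  have h6 : R = (R * (1 - 1/N^2)) * (N^2 / (N^2-1)) := by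
    field_simp
  rw [h6]
  calc _ ≤ (N * Real.exp (-((c-1)^2/(2*c)) * ((Nat.clog 2 m : ℝ) - 1))) * (N^2 / (N^2-1)) :=
        mul_le_mul_of_nonneg_right h5 (by positivity)
    _ = _ := by ring
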